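/- In a minimal counterexample (G, S, R, v, P_k(v), Q, k) to the Extension Theorem, the set S has at least 3 vertices, i.e., |S| ≥ 3. -/

import Mathlib

/-!
Multigraphs are modelled by a vertex type `V`, an edge type `E`, and an
incidence map `ends : E → Sym2 V` giving the (unordered) pair of endpoints
of each edge.  Subgraphs are identified with their edge sets (`Set E`).
-/

namespace SteinerPacking

variable {V E : Type}

/-- The set of edges incident to a vertex `u` (denoted `E(u)` in the paper). -/
def incEdges (ends : E → Sym2 V) (u : V) : Set E := {e | u ∈ ends e}

/-- The degree `d(u) = |E(u)|` of a vertex. -/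
noncomputable def deg (ends : E → Sym2 V) (u : V) : ℕ := (incEdges ends u).ncard

/-- One step along an edge of the edge set `F`. -/
def Step (ends : E → Sym2 V) (F : Set E) (a b : V) : Prop := ∃ e ∈ F, ends e = s(a, b)

/-- `a` and `b` are joined by a walk using only edges in `F`. -/
def Reaches (ends : E → Sym2 V) (F : Set E) (a b : V) : Prop :=
  Relation.ReflTransGen (Step ends F) a b

/-- The vertex set `S` is connected in the subgraph with edge set `F`. -/
def ConnectsSet (ends : E → Sym2 V) (F : Set E) (S : Set V) : Prop :=
  ∀ a ∈ S, ∀ b ∈ S, Reaches ends F a b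

/-- A walk from `u` to `w` given by a list of edges. -/
inductive IsWalk (ends : E → Sym2 V) : V → V → List E → Prop
  | nil (v : V) : IsWalk ends v v []
  | cons {u v w : V} {e : E} {l : List E} :
      ends e = s(u, v) → IsWalk ends v w l → IsWalk ends u w (e :: l)

/-- A path from `u` to `v` using edges of `F` (a walk with no repeated edges). -/
def IsPathIn (ends : E → Sym2 V) (F : Set E) (u v : V) (l : List E) : Prop :=
  IsWalk ends u v l ∧ l.Nodup ∧ ∀ e ∈ l, e ∈ F

/-- There are `n` pairwise edge-disjoint paths from `u` to `v` inside `F`. -/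
def EdgeDisjointPathsIn (ends : E → Sym2 V) (F : Set E) (n : ℕ) (u v : V) : Prop :=
  ∃ P : Fin n → List E, (∀ i, IsPathIn ends F u v (P i)) ∧
    ∀ i j, i ≠ j → ∀ e ∈ P i, e ∉ P j

/-- `S` is `n`-edge-connected in the (sub)graph with edge set `F`:
any two distinct vertices of `S` are joined by `n` edge-disjoint paths. -/
def EdgeConnectedIn (ends : E → Sym2 V) (F : Set E) (S : Set V) (n : ℕ) : Prop :=
  ∀ a ∈ S, ∀ b ∈ S, a ≠ b → EdgeDisjointPathsIn ends F n a b

/-- A family of subgraphs (edge sets) is pairwise edge-disjoint. -/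
def PairwiseEdgeDisjoint {k : ℕ} (H : Fin k → Set E) : Prop :=
  ∀ i j, i ≠ j → Disjoint (H i) (H j)

/-- `v` is a cut vertex of the subgraph with edge set `H`: some two vertices
distinct from `v` are connected in `H` but not after removing `v`. -/
def IsCutVertexOf (ends : E → Sym2 V) (H : Set E) (v : V) : Prop :=
  ∃ a b : V, a ≠ v ∧ b ≠ v ∧ Reaches ends H a b ∧
    ¬ Reaches ends {e ∈ H | v ∉ ends e} a b

/-- A subpartition of `E(v)` into `k` (possibly empty) parts. -/
def IsSubpartitionAt {k : ℕ} (ends : E → Sym2 V) (v : V) (P : Fin k → Set E) : Prop :=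
  (∀ i, P i ⊆ incEdges ends v) ∧ ∀ i j, i ≠ j → Disjoint (P i) (P j)

/-- A balanced partition of `E(v)` into `k` parts: each part has ≥ 2 edges. -/
def IsBalancedPartitionAt {k : ℕ} (ends : E → Sym2 V) (v : V) (P : Fin k → Set E) : Prop :=
  IsSubpartitionAt ends v P ∧ (⋃ i, P i) = incEdges ends v ∧ ∀ i, 2 ≤ (P i).ncard

/-- A balanced subpartition of `E(v)`: one extendable to a balanced partition. -/
def IsBalancedSubpartitionAt {k : ℕ} (ends : E → Sym2 V) (v : V) (P : Fin k → Set E) : Prop :=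
  IsSubpartitionAt ends v P ∧
    ∃ P' : Fin k → Set E, IsBalancedPartitionAt ends v P' ∧ ∀ i, P i ⊆ P' i

/-- The subgraphs `H 1, …, H k` extend the subpartition `P` at `v`:
`P i ⊆ H i` and `v` is not a cut vertex of any `H i`. -/
def Extend {k : ℕ} (ends : E → Sym2 V) (v : V) (P H : Fin k → Set E) : Prop :=
  ∀ i, P i ⊆ H i ∧ ¬ IsCutVertexOf ends (H i) v

/-- The subgraphs `H 1, …, H k` balance the vertex `u`. -/
def BalanceVertex {k : ℕ} (ends : E → Sym2 V) (H : Fin k → Set E) (u : V) : Prop :=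
  IsBalancedSubpartitionAt ends u (fun i => incEdges ends u ∩ H i)

/-- The subgraphs `H 1, …, H k` balance every vertex of `T`. -/
def BalanceSet {k : ℕ} (ends : E → Sym2 V) (H : Fin k → Set E) (T : Set V) : Prop :=
  ∀ u ∈ T, BalanceVertex ends H u

/-- A loopless multigraph. -/
def Loopless (ends : E → Sym2 V) : Prop := ∀ e : E, ¬ (ends e).IsDiag

/-- The set of neighbors of a vertex. -/
def neighbors (ends : E → Sym2 V) (u : V) : Set V := {w | ∃ e, ends e = s(u, w)}

/-- There is no family of `k` pairwise edge-disjoint `S`-subgraphs that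
balance `S ∪ R` and extend the subpartition `P` at `v`. -/
def NoGoodPacking {k : ℕ} (ends : E → Sym2 V) (S R : Set V) (v : V)
    (P : Fin k → Set E) : Prop :=
  ¬ ∃ H : Fin k → Set E, PairwiseEdgeDisjoint H ∧ (∀ i, ConnectsSet ends (H i) S) ∧
      BalanceSet ends H (S ∪ R) ∧ Extend ends v P H

/-- `(G, S, R, v, P, Q, k)` is a counterexample to the Extension Theorem:
it satisfies all hypotheses of the Extension Theorem (including that every
label appears at least twice at `v`), yet admits no good packing. -/
def ExtCex (Q k : ℕ) (ends : E → Sym2 V) (S R : Set V) (v : V)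
    (P : Fin k → Set E) : Prop :=
  36 ≤ Q ∧ 0 < k ∧ Disjoint S R ∧ 2 ≤ S.ncard ∧
  EdgeConnectedIn ends Set.univ S (Q * k) ∧
  (∀ r ∈ R, (Q - 2) * k ≤ deg ends r) ∧
  v ∈ S ∧ (∀ e : E, v ∈ ends e → ¬ (ends e).IsDiag) ∧
  deg ends v = Q * k ∧
  IsBalancedSubpartitionAt ends v P ∧ (∀ i, 2 ≤ (P i).ncard) ∧
  NoGoodPacking ends S R v P

/-- The measure used for minimality: number of vertices plus number of
non-loop edges. -/
noncomputable def extMeasure (ends : E → Sym2 V) : ℕ :=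
  Nat.card V + {e : E | ¬ (ends e).IsDiag}.ncard

/-- A minimal counterexample to the Extension Theorem: a counterexample whose
measure is at most the measure of every counterexample (with the same `Q`, `k`). -/
def MinExtCex (Q k : ℕ) (ends : E → Sym2 V) (S R : Set V) (v : V)
    (P : Fin k → Set E) : Prop :=
  ExtCex Q k ends S R v P ∧
  ∀ (V' E' : Type) (_ : Finite V') (_ : Finite E') (ends' : E' → Sym2 V')
    (S' R' : Set V') (v' : V') (P' : Fin k → Set E'),
    ExtCex Q k ends' S' R' v' P' → extMeasure ends ≤ extMeasure ends'

theorem Reaches.symm {ends : E → Sym2 V} {F : Set E} {a b : V} (h : Reaches ends F a b) :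
    Reaches ends F b a := by
  induction h with
  | refl => exact Relation.ReflTransGen.refl
  | tail _ hstep ih =>
    obtain ⟨e, he, hxy⟩ := hstep
    exact Relation.ReflTransGen.head ⟨e, he, by rw [hxy, Sym2.eq_swap]⟩ ih

theorem Reaches.mono {ends : E → Sym2 V} {F F' : Set E} (hF : F ⊆ F') {a b : V}
    (h : Reaches ends F a b) : Reaches ends F' a b :=
  Relation.ReflTransGen.mono (fun _ _ ⟨e, he, hxy⟩ => ⟨e, hF he, hxy⟩) _ _ h

/-- A vertex from which another vertex is reachable lies on an edge. -/
theorem Reaches.eq_or_exists_mem {ends : E → Sym2 V} {F : Set E} {a b : V}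
    (h : Reaches ends F a b) : a = b ∨ ∃ e ∈ F, a ∈ ends e := by
  rcases Relation.ReflTransGen.cases_head h with h | ⟨c, ⟨e, he, hac⟩, -⟩
  · exact Or.inl h
  · exact Or.inr ⟨e, he, by simp [hac]⟩

/-- Disjoint sets of at least two edges at `u` witness that any smaller parts are balanced. -/
theorem isBalancedSubpartitionAt_of_subset [Finite E] {k : ℕ} (hk : 0 < k)
    {ends : E → Sym2 V} {u : V} {A B : Fin k → Set E} (hAB : ∀ i, A i ⊆ B i)
    (hB : IsSubpartitionAt ends u B) (hcard : ∀ i, 2 ≤ (B i).ncard) :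
    IsBalancedSubpartitionAt ends u A := by
  classical
  let C : Fin k → Set E := fun i =>
    if i = ⟨0, hk⟩ then B i ∪ (incEdges ends u \ ⋃ j, B j) else B i
  have hBC : ∀ i, B i ⊆ C i := by
    intro i
    by_cases hi : i = ⟨0, hk⟩ <;> simp [C, hi]
  have hC : ∀ i, ∀ e ∈ C i, e ∈ B i ∨ (i = ⟨0, hk⟩ ∧ e ∈ incEdges ends u ∧ ∀ j, e ∉ B j) := by
    intro i e he
    by_cases hi : i = ⟨0, hk⟩
    · simpa [C, hi] using he
    · left
      simpa [C, hi] using he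
  have hCsub : ∀ i, C i ⊆ incEdges ends u := by
    intro i e he
    rcases hC i e he with h | h
    · exact hB.1 i h
    · exact h.2.1
  refine ⟨⟨fun i => (hAB i).trans (hB.1 i),
    fun i j hij => (hB.2 i j hij).mono (hAB i) (hAB j)⟩, C, ⟨⟨hCsub, ?_⟩, ?_, ?_⟩,
    fun i => (hAB i).trans (hBC i)⟩
  · intro i j hij
    rw [Set.disjoint_left]
    intro e hi hj
    rcases hC i e hi with h | h <;> rcases hC j e hj with h' | h'
    · exact Set.disjoint_left.1 (hB.2 i j hij) h h'
    · exact h'.2.2 i h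
    · exact h.2.2 j h'
    · exact hij (h.1.trans h'.1.symm)
  · refine Set.Subset.antisymm (Set.iUnion_subset hCsub) fun e he => ?_
    by_cases h : ∃ j, e ∈ B j
    · obtain ⟨j, hj⟩ := h
      exact Set.mem_iUnion.2 ⟨j, hBC j hj⟩
    · push Not at h
      refine Set.mem_iUnion.2 ⟨⟨0, hk⟩, ?_⟩
      simp [C, he, h]
  · exact fun i => (hcard i).trans (Set.ncard_le_ncard (hBC i) (Set.toFinite _))

/-- Parts leaving at least `2 * k` edges at `u` unused are balanced. -/
theorem isBalancedSubpartitionAt_of_unused [Finite E] {k : ℕ} (hk : 0 < k)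
    {ends : E → Sym2 V} {u : V} {A : Fin k → Set E} (hA : IsSubpartitionAt ends u A)
    (hfree : 2 * k ≤ (incEdges ends u \ ⋃ i, A i).ncard) :
    IsBalancedSubpartitionAt ends u A := by
  classical
  set F := incEdges ends u \ ⋃ i, A i
  have : Fintype F := Fintype.ofFinite F
  have hcard : Fintype.card (Fin k × Fin 2) ≤ Fintype.card F := by
    rw [Fintype.card_prod, Fintype.card_fin, Fintype.card_fin, ← Nat.card_eq_fintype_card (α := F),
      Nat.card_coe_set_eq]
    omega
  obtain ⟨f⟩ := Function.Embedding.nonempty_of_card_le hcard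
  have hf : ∀ q, (f q : E) ∈ incEdges ends u ∧ ∀ i, (f q : E) ∉ A i := by
    intro q
    obtain ⟨h1, h2⟩ : (f q : E) ∈ incEdges ends u \ ⋃ i, A i := (f q).2
    exact ⟨h1, fun i hi => h2 (Set.mem_iUnion.2 ⟨i, hi⟩)⟩
  let C : Fin k → Set E := fun i => Set.range fun s : Fin 2 => (f (i, s) : E)
  have hinj : ∀ q q', (f q : E) = f q' → q = q' := fun q q' h => f.injective (Subtype.ext h)
  refine isBalancedSubpartitionAt_of_subset hk (B := fun i => A i ∪ C i)
    (fun i => Set.subset_union_left) ⟨?_, ?_⟩ ?_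
  · rintro i e (he | ⟨s, rfl⟩)
    · exact hA.1 i he
    · exact (hf _).1
  · intro i j hij
    rw [Set.disjoint_left]
    rintro e (he | ⟨s, rfl⟩) (he' | ⟨t, (h : (f (j, t) : E) = _)⟩)
    · exact Set.disjoint_left.1 (hA.2 i j hij) he he'
    · exact (hf (j, t)).2 i (h ▸ he)
    · exact (hf (i, s)).2 j he'
    · exact hij (congrArg Prod.fst (hinj _ _ h)).symm
  · intro i
    have h2 : (C i).ncard = 2 := by
      rw [← Nat.card_coe_set_eq, Nat.card_range_of_injective, Nat.card_eq_fintype_card,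
        Fintype.card_fin]
      intro s t h
      exact congrArg Prod.snd (hinj _ _ h)
    rw [← h2]
    exact Set.ncard_le_ncard Set.subset_union_right (Set.toFinite _)

/-- Every walk contains a walk without repeated vertices, given by its vertex and edge sequences. -/
theorem IsWalk.exists_simple {ends : E → Sym2 V} {a b : V} {l : List E} (h : IsWalk ends a b l)
    (e₀ : E) : ∃ (n : ℕ) (p : ℕ → V) (d : ℕ → E), p 0 = a ∧ p n = b ∧
      Set.InjOn p (Set.Iic n) ∧ ∀ t < n, ends (d t) = s(p t, p (t + 1)) ∧ d t ∈ l := by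
  induction h with
  | nil x => exact ⟨0, fun _ => x, fun _ => e₀, rfl, rfl, fun s hs t ht _ => by simp_all, by simp⟩
  | @cons x y z e l he _ ih =>
    obtain ⟨n, p, d, h0, hn, hinj, hd⟩ := ih
    by_cases hx : ∃ t ≤ n, p t = x
    · obtain ⟨t, ht, rfl⟩ := hx
      refine ⟨n - t, fun m => p (m + t), fun m => d (m + t), by simp, ?_, ?_, ?_⟩
      · simp only [Nat.sub_add_cancel ht, hn]
      · intro m hm m' hm' hmm
        have := hinj (Set.mem_Iic.2 (by simp at hm; omega))
          (Set.mem_Iic.2 (by simp at hm'; omega)) hmm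
        omega
      · intro m hm
        have := hd (m + t) (by omega)
        refine ⟨?_, List.mem_cons_of_mem _ this.2⟩
        rw [this.1, show m + t + 1 = m + 1 + t by omega]
    · push Not at hx
      refine ⟨n + 1, fun m => m.casesOn x p, fun m => m.casesOn e d, rfl, hn, ?_, ?_⟩
      · rintro (_ | m) hm (_ | m') hm' hmm
        · rfl
        · exact absurd hmm.symm (hx m' (by simp at hm'; omega))
        · exact absurd hmm (hx m (by simp at hm; omega))
        · exact congrArg (· + 1) (hinj (by simpa using hm) (by simpa using hm') hmm)
      · rintro (_ | m) hm
        · exact ⟨by simpa [h0] using he, by simp⟩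
        · have := hd m (by omega)
          exact ⟨this.1, List.mem_cons_of_mem _ this.2⟩

/-- A family of edge-disjoint paths from `a` to `b`, each without repeated vertices. -/
structure PathSystem (ends : E → Sym2 V) (a b : V) (ι : Type) where
  /-- The number of edges of each path. -/
  len : ι → ℕ
  /-- The vertex sequence of each path. -/
  vert : ι → ℕ → V
  /-- The edge sequence of each path. -/
  edge : ι → ℕ → E
  vert_zero : ∀ j, vert j 0 = a
  vert_len : ∀ j, vert j (len j) = b
  vert_inj : ∀ j, Set.InjOn (vert j) (Set.Iic (len j))
  ends_edge : ∀ j, ∀ t < len j, ends (edge j t) = s(vert j t, vert j (t + 1))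
  edge_disjoint : ∀ i j s t, s < len i → t < len j → edge i s = edge j t → i = j

theorem EdgeDisjointPathsIn.exists_pathSystem {ends : E → Sym2 V} {F : Set E} {n : ℕ} {a b : V}
    (h : EdgeDisjointPathsIn ends F n a b) (e₀ : E) :
    Nonempty (PathSystem ends a b (Fin n)) := by
  obtain ⟨P, hP, hdisj⟩ := h
  choose len p d h0 hn hinj hd using fun j => (hP j).1.exists_simple e₀
  refine ⟨⟨len, p, d, h0, hn, hinj, fun j t ht => (hd j t ht).1, ?_⟩⟩
  intro i j s t hs ht hst
  by_contra hij
  exact hdisj i j hij _ (hd i s hs).2 (hst ▸ (hd j t ht).2)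

namespace PathSystem

variable {ends : E → Sym2 V} {a b : V} {ι : Type} (W : PathSystem ends a b ι)

theorem vert_eq {j : ι} {s t : ℕ} (hs : s ≤ W.len j) (ht : t ≤ W.len j)
    (h : W.vert j s = W.vert j t) : s = t :=
  W.vert_inj j hs ht h

theorem len_pos (hab : a ≠ b) (j : ι) : 0 < W.len j := by
  rw [Nat.pos_iff_ne_zero]
  intro h
  have := W.vert_len j
  rw [h, W.vert_zero] at this
  exact hab this

theorem edge_eq {i j : ι} {s t : ℕ} (hs : s < W.len i) (ht : t < W.len j)
    (h : W.edge i s = W.edge j t) : i = j ∧ s = t := by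
  obtain rfl := W.edge_disjoint i j s t hs ht h
  refine ⟨rfl, ?_⟩
  have he : s(W.vert i s, W.vert i (s + 1)) = s(W.vert i t, W.vert i (t + 1)) := by
    rw [← W.ends_edge i s hs, ← W.ends_edge i t ht, h]
  rcases Sym2.eq_iff.1 he with h | h
  · exact W.vert_eq hs.le ht.le h.1
  · have h1 := W.vert_eq hs.le ht h.1
    have h2 := W.vert_eq hs ht.le h.2
    omega

theorem notMem_ends {j : ι} {t : ℕ} (h0 : 0 < t) (ht : t < W.len j) :
    a ∉ ends (W.edge j t) := by
  rw [W.ends_edge j t ht, Sym2.mem_iff, not_or]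
  constructor <;> intro h
  · have := W.vert_eq (Nat.zero_le _) ht.le ((W.vert_zero j).trans h)
    omega
  · have := W.vert_eq (Nat.zero_le _) ht ((W.vert_zero j).trans h)
    omega

/-- The edges through which the paths enter `x`. -/
def inEdges (x : V) : Set E := {e | ∃ j, ∃ t < W.len j, e = W.edge j t ∧ W.vert j (t + 1) = x}

theorem two_mul_ncard_inEdges_le [Finite E] {x : V} (hb : x ≠ b) :
    2 * (W.inEdges x).ncard ≤ deg ends x := by
  let T : Set (ι × ℕ) := {q | q.2 + 1 < W.len q.1 ∧ W.vert q.1 (q.2 + 1) = x}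
  have hin : W.inEdges x = (fun q : ι × ℕ => W.edge q.1 q.2) '' T := by
    ext e
    constructor
    · rintro ⟨j, t, ht, rfl, hx⟩
      refine ⟨(j, t), ⟨?_, hx⟩, rfl⟩
      refine lt_of_le_of_ne ht fun h => hb ?_
      rw [← hx]
      exact (congrArg _ h).trans (W.vert_len j)
    · rintro ⟨⟨j, t⟩, ⟨ht, hx⟩, rfl⟩
      exact ⟨j, t, Nat.lt_of_succ_lt ht, rfl, hx⟩
  let O : Set E := (fun q : ι × ℕ => W.edge q.1 (q.2 + 1)) '' T
  have hI : (W.inEdges x).ncard = T.ncard := by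
    rw [hin]
    refine Set.InjOn.ncard_image ?_
    rintro ⟨i, s⟩ ⟨hs, -⟩ ⟨j, t⟩ ⟨ht, -⟩ h
    obtain ⟨rfl, rfl⟩ := W.edge_eq (Nat.lt_of_succ_lt hs) (Nat.lt_of_succ_lt ht) h
    rfl
  have hO : O.ncard = T.ncard := by
    refine Set.InjOn.ncard_image ?_
    rintro ⟨i, s⟩ ⟨hs, -⟩ ⟨j, t⟩ ⟨ht, -⟩ h
    obtain ⟨rfl, h⟩ := W.edge_eq hs ht h
    obtain rfl := Nat.succ_injective h
    rfl
  have hdisj : Disjoint (W.inEdges x) O := by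
    rw [hin, Set.disjoint_left]
    rintro _ ⟨⟨i, s⟩, ⟨hs, hsx⟩, rfl⟩ ⟨⟨j, t⟩, ⟨ht, htx⟩, h⟩
    dsimp only at hs hsx ht htx h
    obtain ⟨rfl, h⟩ := W.edge_eq ht (Nat.lt_of_succ_lt hs) h
    have := W.vert_eq hs.le ht.le (hsx.trans htx.symm)
    omega
  have hsub : W.inEdges x ∪ O ⊆ incEdges ends x := by
    rintro e (⟨j, t, ht, rfl, hx⟩ | ⟨⟨j, t⟩, ⟨ht, hx⟩, rfl⟩)
    · simp [incEdges, W.ends_edge j t ht, hx]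
    · dsimp only at ht hx
      simp [incEdges, W.ends_edge j (t + 1) ht, hx]
  have := Set.ncard_le_ncard hsub (Set.toFinite _)
  rw [Set.ncard_union_eq hdisj (Set.toFinite _) (Set.toFinite _), hI, hO] at this
  rw [hI, deg]
  omega

/-- The paths indexed by `J` can be merged into a subgraph in which every vertex other than `a`
still reaches `b` without using `a`, but which leaves every vertex through at most one edge. -/
theorem exists_merge [Finite E] (hab : a ≠ b) (J : Set ι) : ∃ H : Set E,
    (∀ e ∈ H, ∃ j ∈ J, ∃ t < W.len j, e = W.edge j t) ∧
    (∀ j ∈ J, W.edge j 0 ∈ H) ∧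
    (∀ e ∈ H, a ∈ ends e → ∃ j ∈ J, e = W.edge j 0) ∧
    (∀ x ≠ a, (∃ e ∈ H, x ∈ ends e) → Reaches ends {e ∈ H | a ∉ ends e} x b) ∧
    ∀ x ≠ a, ∃ o : Set E, o.ncard ≤ 1 ∧ ∀ e ∈ H, x ∈ ends e → e ∈ o ∨ e ∈ W.inEdges x := by
  classical
  let D : V → Set (ι × ℕ) := fun x =>
    {q | q.1 ∈ J ∧ 0 < q.2 ∧ q.2 < W.len q.1 ∧ W.vert q.1 q.2 = x}
  let μ : ι × ℕ → ℕ := fun q => W.len q.1 - q.2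
  have hmin : ∀ x, ∃ N : Set (ι × ℕ), N.Subsingleton ∧ N ⊆ D x ∧
      ∀ q ∈ D x, ∃ q' ∈ N, μ q' ≤ μ q := by
    intro x
    by_cases hx : (D x).Nonempty
    · refine ⟨{Function.argminOn μ (D x) hx}, Set.subsingleton_singleton, ?_, ?_⟩
      · simp
      · exact fun q hq => ⟨_, rfl, Function.argminOn_le μ (D x) hq⟩
    · rw [Set.not_nonempty_iff_eq_empty] at hx
      exact ⟨∅, Set.subsingleton_empty, Set.empty_subset _, by simp [hx]⟩
  choose N hNs hND hNmin using hmin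
  let H : Set E := {e | (∃ j ∈ J, e = W.edge j 0) ∨ ∃ x, ∃ q ∈ N x, e = W.edge q.1 q.2}
  have hpath : ∀ e ∈ H, ∃ j ∈ J, ∃ t < W.len j, e = W.edge j t := by
    rintro e (⟨j, hj, rfl⟩ | ⟨x, q, hq, rfl⟩)
    · exact ⟨j, hj, 0, W.len_pos hab j, rfl⟩
    · obtain ⟨h1, -, h3, -⟩ := hND x hq
      exact ⟨q.1, h1, q.2, h3, rfl⟩
  have hreach : ∀ m, ∀ j ∈ J, ∀ t, 0 < t → t ≤ W.len j → W.len j - t ≤ m →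
      Reaches ends {e ∈ H | a ∉ ends e} (W.vert j t) b := by
    intro m
    induction m with
    | zero =>
      intro j _ t _ ht hm
      rw [show t = W.len j by omega, W.vert_len]
      exact Relation.ReflTransGen.refl
    | succ m ih =>
      intro j hj t h0 ht hm
      rcases ht.eq_or_lt with rfl | ht
      · rw [W.vert_len]
        exact Relation.ReflTransGen.refl
      · obtain ⟨⟨i, s⟩, hq, hle⟩ := hNmin (W.vert j t) (j, t) ⟨hj, h0, ht, rfl⟩
        obtain ⟨hi, hs0, hs, hx⟩ := hND _ hq
        dsimp only [μ] at hi hs0 hs hx hle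
        rw [← hx]
        refine Relation.ReflTransGen.head (b := W.vert i (s + 1))
          ⟨W.edge i s, ⟨Or.inr ⟨_, _, hq, rfl⟩, W.notMem_ends hs0 hs⟩, W.ends_edge i s hs⟩ ?_
        exact ih i hi (s + 1) (Nat.succ_pos _) hs (by omega)
  refine ⟨H, hpath, fun j hj => Or.inl ⟨j, hj, rfl⟩, ?_, ?_, ?_⟩
  · rintro e (h | ⟨x, q, hq, rfl⟩) ha
    · exact h
    · obtain ⟨-, h2, h3, -⟩ := hND x hq
      exact absurd ha (W.notMem_ends h2 h3)
  · rintro x hx ⟨e, he, hxe⟩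
    obtain ⟨j, hj, t, ht, rfl⟩ := hpath e he
    rw [W.ends_edge j t ht, Sym2.mem_iff] at hxe
    rcases hxe with rfl | rfl
    · refine hreach _ j hj t (Nat.pos_of_ne_zero ?_) ht.le le_rfl
      rintro rfl
      exact hx (W.vert_zero j)
    · exact hreach _ j hj (t + 1) (Nat.succ_pos _) ht le_rfl
  · intro x hx
    refine ⟨(fun q : ι × ℕ => W.edge q.1 q.2) '' N x,
      Set.ncard_le_one_iff_subsingleton.2 ((hNs x).image _), ?_⟩
    rintro e (⟨j, hj, rfl⟩ | ⟨y, q, hq, rfl⟩) hxe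
    · have h0 := W.len_pos hab j
      rw [W.ends_edge j 0 h0, Sym2.mem_iff, W.vert_zero] at hxe
      exact Or.inr ⟨j, 0, h0, rfl, (hxe.resolve_left hx).symm⟩
    · obtain ⟨-, -, h3, h4⟩ := hND y hq
      rw [W.ends_edge _ _ h3, Sym2.mem_iff] at hxe
      rcases hxe with h | h
      · obtain rfl : x = y := h.trans h4
        exact Or.inl ⟨q, hq, rfl⟩
      · exact Or.inr ⟨q.1, q.2, h3, rfl, h.symm⟩

end PathSystem

/-- Edge-disjoint paths from `v` to `u` that exhaust the edges at `v` can be merged into a packing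
that extends a given balanced subpartition at `v`. -/
theorem exists_packing_of_edgeDisjointPathsIn [Finite E] {Q k : ℕ} (hQ : 8 ≤ Q) (hk : 0 < k)
    {ends : E → Sym2 V} {u v : V} (huv : v ≠ u) {R : Set V} {P : Fin k → Set E}
    (hpaths : EdgeDisjointPathsIn ends Set.univ (Q * k) v u) (hdeg : deg ends v = Q * k)
    (hR : ∀ r ∈ R, r ≠ v ∧ r ≠ u ∧ (Q - 2) * k ≤ deg ends r)
    (hP : IsSubpartitionAt ends v P) (hP2 : ∀ i, 2 ≤ (P i).ncard) :
    ∃ H : Fin k → Set E, PairwiseEdgeDisjoint H ∧ (∀ i, ConnectsSet ends (H i) {v, u}) ∧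
      BalanceSet ends H ({v, u} ∪ R) ∧ Extend ends v P H := by
  obtain ⟨e₀, -⟩ : (P ⟨0, hk⟩).Nonempty :=
    Set.nonempty_of_ncard_ne_zero (by have := hP2 ⟨0, hk⟩; omega)
  obtain ⟨W⟩ := hpaths.exists_pathSystem e₀
  have hlen := W.len_pos huv
  have hfirst_inj : Function.Injective fun j => W.edge j 0 :=
    fun i j h => (W.edge_eq (hlen i) (hlen j) h).1
  have hfirst : Set.range (fun j => W.edge j 0) = incEdges ends v := by
    refine Set.eq_of_subset_of_ncard_le ?_ ?_ (Set.toFinite _)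
    · rintro _ ⟨j, rfl⟩
      simp [incEdges, W.ends_edge j 0 (hlen j), W.vert_zero]
    · rw [← Nat.card_coe_set_eq (Set.range _), Nat.card_range_of_injective hfirst_inj, Nat.card_fin]
      exact hdeg.le
  let J : Fin k → Set (Fin (Q * k)) := fun i => {j | W.edge j 0 ∈ P i}
  have hJP : ∀ i, (fun j => W.edge j 0) '' J i = P i := by
    intro i
    refine Set.image_preimage_eq_of_subset ?_
    rw [hfirst]
    exact hP.1 i
  have hJ2 : ∀ i, 2 ≤ (J i).ncard := by
    intro i
    rw [← hfirst_inj.injOn.ncard_image, hJP]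
    exact hP2 i
  have hJdisj : ∀ i i' j, j ∈ J i → j ∈ J i' → i = i' := by
    intro i i' j hj hj'
    by_contra h
    exact Set.disjoint_left.1 (hP.2 i i' h) hj hj'
  choose H hpath hH0 hHv hreach hout using fun i => W.exists_merge huv (J i)
  have hPH : ∀ i, P i ⊆ H i := by
    intro i e he
    rw [← hJP i] at he
    obtain ⟨j, hj, rfl⟩ := he
    exact hH0 i j hj
  have hdisj : PairwiseEdgeDisjoint H := by
    intro i i' h
    rw [Set.disjoint_left]
    intro e he he'
    obtain ⟨j, hj, s, hs, rfl⟩ := hpath i e he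
    obtain ⟨j', hj', t, ht, h'⟩ := hpath i' _ he'
    obtain ⟨rfl, -⟩ := W.edge_eq hs ht h'
    exact h (hJdisj i i' j hj hj')
  have hsub : ∀ x, IsSubpartitionAt ends x fun i => incEdges ends x ∩ H i := fun x =>
    ⟨fun i => Set.inter_subset_left, fun i i' h =>
      (hdisj i i' h).mono Set.inter_subset_right Set.inter_subset_right⟩
  have hvu : ∀ i, Reaches ends (H i) v u := by
    intro i
    obtain ⟨j, hj⟩ : (J i).Nonempty :=
      Set.nonempty_of_ncard_ne_zero (by have := hJ2 i; omega)
    have he := W.ends_edge j 0 (hlen j)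
    have hne : W.vert j 1 ≠ v := fun h => by
      have := W.vert_eq (hlen j) (Nat.zero_le _) (h.trans (W.vert_zero j).symm)
      omega
    refine Relation.ReflTransGen.head (b := W.vert j 1)
      ⟨W.edge j 0, hH0 i j hj, by rw [he, W.vert_zero]⟩ ?_
    exact (hreach i _ hne ⟨_, hH0 i j hj, by simp [he]⟩).mono fun e he => he.1
  refine ⟨H, hdisj, ?_, ?_, fun i => ⟨hPH i, ?_⟩⟩
  · rintro i x (rfl | rfl) y (rfl | rfl)
    · exact Relation.ReflTransGen.refl
    · exact hvu i
    · exact (hvu i).symm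
    · exact Relation.ReflTransGen.refl
  · rintro x ((rfl | rfl) | hx)
    · refine isBalancedSubpartitionAt_of_subset hk ?_ hP hP2
      rintro i e ⟨hxe, he⟩
      obtain ⟨j, hj, rfl⟩ := hHv i e he hxe
      exact hj
    · have hlast_inj : Function.Injective fun j => W.edge j (W.len j - 1) := fun i j h =>
        (W.edge_eq (Nat.sub_lt (hlen i) one_pos) (Nat.sub_lt (hlen j) one_pos) h).1
      refine isBalancedSubpartitionAt_of_subset hk
        (B := fun i => (fun j => W.edge j (W.len j - 1)) '' J i) ?_ ⟨?_, ?_⟩ ?_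
      · rintro i e ⟨hxe, he⟩
        obtain ⟨j, hj, t, ht, rfl⟩ := hpath i e he
        refine ⟨j, hj, ?_⟩
        have hxe : x ∈ ends (W.edge j t) := hxe
        rw [W.ends_edge j t ht, Sym2.mem_iff] at hxe
        have hlt : t + 1 = W.len j := by
          rcases hxe with h | h
          · have := W.vert_eq ht.le le_rfl (h.symm.trans (W.vert_len j).symm)
            omega
          · exact W.vert_eq ht le_rfl (h.symm.trans (W.vert_len j).symm)
        simp [← hlt]
      · rintro i _ ⟨j, -, rfl⟩
        have := hlen j
        simp [incEdges, W.ends_edge j (W.len j - 1) (by omega), Nat.sub_add_cancel this,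
          W.vert_len]
      · intro i i' h
        rw [Set.disjoint_left]
        rintro _ ⟨j, hj, rfl⟩ ⟨j', hj', hjj⟩
        obtain rfl := hlast_inj hjj
        exact h (hJdisj i i' _ hj hj')
      · intro i
        rw [hlast_inj.injOn.ncard_image]
        exact hJ2 i
    · obtain ⟨hxv, hxu, hxd⟩ := hR x hx
      refine isBalancedSubpartitionAt_of_unused hk (hsub x) ?_
      choose o ho1 ho using fun i => hout i x hxv
      have hused : (⋃ i, incEdges ends x ∩ H i) ⊆ W.inEdges x ∪ ⋃ i, o i := by
        refine Set.iUnion_subset ?_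
        rintro i e ⟨hxe, he⟩
        rcases ho i e he hxe with h | h
        · exact Or.inr (Set.mem_iUnion.2 ⟨i, h⟩)
        · exact Or.inl h
      have ho_card : (⋃ i, o i).ncard ≤ k := by
        calc (⋃ i, o i).ncard ≤ ∑ i, (o i).ncard := Set.ncard_iUnion_le_of_fintype o
          _ ≤ ∑ _i : Fin k, 1 := Finset.sum_le_sum fun i _ => ho1 i
          _ = k := by simp
      have h1 := Set.ncard_le_ncard hused (Set.toFinite _)
      have h2 := Set.ncard_union_le (W.inEdges x) (⋃ i, o i)
      have h3 := W.two_mul_ncard_inEdges_le hxu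
      have h4 := Set.le_ncard_sdiff (⋃ i, incEdges ends x ∩ H i) (incEdges ends x)
      have h5 : 6 * k ≤ deg ends x := (Nat.mul_le_mul_right k (by omega)).trans hxd
      unfold deg at h3 h5
      omega
  · rintro ⟨a, b, ha, hb, hab, hnot⟩
    have hcase : ∀ c d, c ≠ v → Reaches ends (H i) c d →
        c = d ∨ Reaches ends {e ∈ H i | v ∉ ends e} c u :=
      fun c d hc h => h.eq_or_exists_mem.imp_right (hreach i c hc)
    rcases hcase a b ha hab with rfl | h
    · exact hnot Relation.ReflTransGen.refl
    · rcases hcase b a hb hab.symm with rfl | h'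
      · exact hnot Relation.ReflTransGen.refl
      · exact hnot (h.trans h'.symm)

/-- In a minimal counterexample to the Extension Theorem,
`|S| ≥ 3`. -/
theorem min_cex_S_card {V E : Type} [Fintype V] [Fintype E]
    (Q k : ℕ) (ends : E → Sym2 V) (S R : Set V) (v : V) (P : Fin k → Set E)
    (h : MinExtCex Q k ends S R v P) :
    3 ≤ S.ncard := by
  obtain ⟨hQ, hk, hSR, hS, hconn, hR, hv, -, hdeg, hP, hP2, hno⟩ := h.1
  by_contra hlt
  obtain ⟨u, hvu, rfl⟩ : ∃ u, v ≠ u ∧ S = {v, u} := by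
    obtain ⟨x, y, hxy, rfl⟩ := Set.ncard_eq_two.1 (show S.ncard = 2 by omega)
    rcases hv with rfl | rfl
    · exact ⟨y, hxy, rfl⟩
    · exact ⟨x, hxy.symm, Set.pair_comm _ _⟩
  refine hno (exists_packing_of_edgeDisjointPathsIn (by omega) hk hvu
    (hconn v (by simp) u (by simp) hvu) hdeg (fun r hr => ⟨?_, ?_, hR r hr⟩) hP.1 hP2)
  · rintro rfl
    exact Set.disjoint_left.1 hSR (by simp) hr
  · rintro rfl
    exact Set.disjoint_left.1 hSR (by simp) hr

end SteinerPacking
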